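/- arXiv:2211.08019 — 3 statements merged into one kernel-verified Lean document; each statement's English description precedes it below -/
import Mathlib

section
/- Let (a,b) ∈ ℂ² \ {(0,0)} and let k ≥ 0 be an integer. For every integer p with 0 ≤ p ≤ k and every point z ∈ ℂ², the second directional derivatives along Y₃ and Y₄ satisfy (Y₃²φ_p)(z) + (Y₄²φ_p)(z) = 2(p − 2pq − q + 1)·φ_p(z), where q := k+1−p (equivalently, the eigenvalue is 2(2p² − 2pk − k)). -/
open Complex

noncomputable section

/-- The vector field `Y₂(z₁,z₂) = (i z₁, i z₂)` on `ℂ²`. -/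
def Y2 (z : ℂ × ℂ) : ℂ × ℂ := (I * z.1, I * z.2)

/-- The vector field `Y₃(z₁,z₂) = (-i conj z₂, i conj z₁)` on `ℂ²`. -/
def Y3 (z : ℂ × ℂ) : ℂ × ℂ := (-I * (starRingEnd ℂ) z.2, I * (starRingEnd ℂ) z.1)

/-- The vector field `Y₄(z₁,z₂) = (conj z₂, -conj z₁)` on `ℂ²`. -/
def Y4 (z : ℂ × ℂ) : ℂ × ℂ := ((starRingEnd ℂ) z.2, -(starRingEnd ℂ) z.1)

/-- Real Fréchet directional derivative of `f` along the vector field `X`. -/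
def YD (X : ℂ × ℂ → ℂ × ℂ) (f : ℂ × ℂ → ℂ) : ℂ × ℂ → ℂ :=
  fun z => fderiv ℝ f z (X z)

/-- `u(z₁,z₂) = a z₁ + b z₂`. -/
def uF (a b : ℂ) (z : ℂ × ℂ) : ℂ := a * z.1 + b * z.2

/-- `v(z₁,z₂) = b conj z₁ - a conj z₂`. -/
def vF (a b : ℂ) (z : ℂ × ℂ) : ℂ :=
  b * (starRingEnd ℂ) z.1 - a * (starRingEnd ℂ) z.2

/-- `φ_p = uᵖ v^(k-p)` for `0 ≤ p ≤ k`, and `0` otherwise. -/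
def phi (a b : ℂ) (k p : ℤ) : ℂ × ℂ → ℂ :=
  fun z => if 0 ≤ p ∧ p ≤ k then uF a b z ^ p.toNat * vF a b z ^ (k - p).toNat else 0

lemma uF_hasFDerivAt (a b : ℂ) (z : ℂ × ℂ) :
    HasFDerivAt (uF a b) (a • ContinuousLinearMap.fst ℝ ℂ ℂ + b • ContinuousLinearMap.snd ℝ ℂ ℂ) z := by
  have := (a • ContinuousLinearMap.fst ℝ ℂ ℂ + b • ContinuousLinearMap.snd ℝ ℂ ℂ).hasFDerivAt (x := z)
  exact this

lemma vF_hasFDerivAt (a b : ℂ) (z : ℂ × ℂ) :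
    HasFDerivAt (vF a b) (b • ((conjCLE : ℂ →L[ℝ] ℂ).comp (ContinuousLinearMap.fst ℝ ℂ ℂ))
      - a • ((conjCLE : ℂ →L[ℝ] ℂ).comp (ContinuousLinearMap.snd ℝ ℂ ℂ))) z := by
  have := (b • ((conjCLE : ℂ →L[ℝ] ℂ).comp (ContinuousLinearMap.fst ℝ ℂ ℂ))
      - a • ((conjCLE : ℂ →L[ℝ] ℂ).comp (ContinuousLinearMap.snd ℝ ℂ ℂ))).hasFDerivAt (x := z)
  exact this

lemma YD_mono (X : ℂ × ℂ → ℂ × ℂ) (u v : ℂ × ℂ → ℂ) (α β : ℂ)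
    (hu : Differentiable ℝ u) (hv : Differentiable ℝ v)
    (hXu : ∀ z, fderiv ℝ u z (X z) = α * v z) (hXv : ∀ z, fderiv ℝ v z (X z) = β * u z)
    (c : ℂ) (m n : ℕ) (z : ℂ × ℂ) :
    fderiv ℝ (fun z => c * (u z ^ m * v z ^ n)) z (X z) =
      (c * m * α) * (u z ^ (m - 1) * v z ^ (n + 1)) +
      (c * n * β) * (u z ^ (m + 1) * v z ^ (n - 1)) := by
  have h := ((((hu z).hasFDerivAt.pow m).mul ((hv z).hasFDerivAt.pow n)).const_mul c)
  have h2 : HasFDerivAt (fun z => c * (u z ^ m * v z ^ n)) _ z := h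
  rw [h2.fderiv]
  simp [hXu, hXv]
  ring

lemma YD_sq (X : ℂ × ℂ → ℂ × ℂ) (u v : ℂ × ℂ → ℂ) (α β : ℂ)
    (hu : Differentiable ℝ u) (hv : Differentiable ℝ v)
    (hXu : ∀ z, fderiv ℝ u z (X z) = α * v z) (hXv : ∀ z, fderiv ℝ v z (X z) = β * u z)
    (m n : ℕ) (z : ℂ × ℂ) :
    YD X (YD X (fun z => u z ^ m * v z ^ n)) z =
      α ^ 2 * ((m * (m - 1 : ℕ)) * (u z ^ (m - 1 - 1) * v z ^ (n + 1 + 1))) +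
      α * β * ((2 * m * n + m + n) * (u z ^ m * v z ^ n)) +
      β ^ 2 * ((n * (n - 1 : ℕ)) * (u z ^ (m + 1 + 1) * v z ^ (n - 1 - 1))) := by
  have h1 : YD X (fun z => u z ^ m * v z ^ n) = fun z =>
      ((m * α) * (u z ^ (m - 1) * v z ^ (n + 1))) +
      ((n * β) * (u z ^ (m + 1) * v z ^ (n - 1))) := by
    funext w
    have := YD_mono X u v α β hu hv hXu hXv 1 m n w
    simpa [YD] using this
  rw [h1]
  unfold YD
  rw [fderiv_fun_add (by fun_prop) (by fun_prop), ContinuousLinearMap.add_apply,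
    YD_mono X u v α β hu hv hXu hXv, YD_mono X u v α β hu hv hXu hXv]
  rcases m with _ | m <;> rcases n with _ | n <;> simp <;> ring

/-- `(Y₃² + Y₄²)(φ_p) = 2 (p - 2pq - q + 1) φ_p` with `q = k + 1 - p`
(the eigenvalue equals `2 (2p² - 2pk - k)`). -/
theorem Y3sq_add_Y4sq_phi (a b : ℂ) (hab : (a, b) ≠ (0, 0)) (k p q : ℤ) (hk : 0 ≤ k)
    (hp0 : 0 ≤ p) (hpk : p ≤ k) (hq : q = k + 1 - p) (z : ℂ × ℂ) :
    YD Y3 (YD Y3 (phi a b k p)) z + YD Y4 (YD Y4 (phi a b k p)) z =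
      ((2 * (p - 2 * p * q - q + 1) : ℤ) : ℂ) * phi a b k p z := by
  have hu : Differentiable ℝ (uF a b) := fun w => (uF_hasFDerivAt a b w).differentiableAt
  have hv : Differentiable ℝ (vF a b) := fun w => (vF_hasFDerivAt a b w).differentiableAt
  obtain ⟨m, rfl⟩ := Int.eq_ofNat_of_zero_le hp0
  obtain ⟨n, hn⟩ := Int.eq_ofNat_of_zero_le (sub_nonneg.2 hpk)
  have hphi : phi a b k m = fun z => uF a b z ^ m * vF a b z ^ n := by
    funext w
    simp [phi, hpk, hn]
  rw [hphi, YD_sq Y3 (uF a b) (vF a b) I I hu hv ?_ ?_ m n z,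
    YD_sq Y4 (uF a b) (vF a b) (-1) 1 hu hv ?_ ?_ m n z]
  · have hk' : k = m + n := by omega
    subst hq
    subst hk'
    rw [I_sq, I_mul_I]
    push_cast
    ring
  · intro w
    rw [(uF_hasFDerivAt a b w).fderiv]
    simp [Y4, vF]
    try ring
  · intro w
    rw [(vF_hasFDerivAt a b w).fderiv]
    simp [Y4, uF]
    try ring
  · intro w
    rw [(uF_hasFDerivAt a b w).fderiv]
    simp [Y3, vF]
    try ring
  · intro w
    rw [(vF_hasFDerivAt a b w).fderiv]
    simp [Y3, uF]
    try ring
end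
end

section
/- Let ε > 0, let (a,b) ∈ ℂ² \ {(0,0)}, let k ≥ 0 be an integer and 0 ≤ p ≤ k. Then for every z ∈ ℂ², −ε⁻²·(Y₂²φ_p)(z) − (Y₃²φ_p)(z) − (Y₄²φ_p)(z) = [k(k+2) + (ε⁻² − 1)(2p−k)²]·φ_p(z). In particular, the restriction of φ_p to the unit sphere S³ is an eigenfunction of the Laplacian Δ^{S³}_ε = −(ε⁻²Y₂² + Y₃² + Y₄²) of the Berger metric g_ε with eigenvalue k(k+2) + (ε⁻² − 1)(2p−k)². -/
open Complex

noncomputable section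

lemma uF_diff (a b : ℂ) : Differentiable ℝ (uF a b) := by
  unfold uF; fun_prop

lemma vF_eq (a b : ℂ) : vF a b = fun z => b * conjCLE z.1 - a * conjCLE z.2 := by
  funext z; simp [vF]

lemma vF_diff (a b : ℂ) : Differentiable ℝ (vF a b) := by
  rw [vF_eq]; fun_prop

lemma fderiv_uF (a b : ℂ) (z w : ℂ × ℂ) : fderiv ℝ (uF a b) z w = uF a b w := by
  have h : IsBoundedLinearMap ℝ (uF a b) := by
    have : uF a b = fun z => (a • ContinuousLinearMap.fst ℝ ℂ ℂ
      + b • ContinuousLinearMap.snd ℝ ℂ ℂ) z := by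
      funext z; simp [uF]
    rw [this]; exact ContinuousLinearMap.isBoundedLinearMap _
  rw [h.fderiv]; rfl

lemma fderiv_vF (a b : ℂ) (z w : ℂ × ℂ) : fderiv ℝ (vF a b) z w = vF a b w := by
  have h : IsBoundedLinearMap ℝ (vF a b) := by
    have : vF a b = fun z => (b • (conjCLE.toContinuousLinearMap.comp
        (ContinuousLinearMap.fst ℝ ℂ ℂ))
      - a • (conjCLE.toContinuousLinearMap.comp (ContinuousLinearMap.snd ℝ ℂ ℂ))) z := by
      funext z; simp [vF]
    rw [this]; exact ContinuousLinearMap.isBoundedLinearMap _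
  rw [h.fderiv]; rfl

/-- Derivative of a two-term combination of monomials in `u, v`. -/
lemma YD_mono_s6 (X : ℂ × ℂ → ℂ × ℂ) (a b c d : ℂ) (m n m' n' : ℕ) (z : ℂ × ℂ) :
    YD X (fun z => c * (uF a b z ^ m * vF a b z ^ n)
      + d * (uF a b z ^ m' * vF a b z ^ n')) z =
    c * (m * uF a b z ^ (m - 1) * uF a b (X z) * vF a b z ^ n
      + n * uF a b z ^ m * vF a b z ^ (n - 1) * vF a b (X z))
    + d * (m' * uF a b z ^ (m' - 1) * uF a b (X z) * vF a b z ^ n'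
      + n' * uF a b z ^ m' * vF a b z ^ (n' - 1) * vF a b (X z)) := by
  have hu := (uF_diff a b z).hasFDerivAt
  have hv := (vF_diff a b z).hasFDerivAt
  have h := (((hu.pow m).mul (hv.pow n)).const_mul c).add
    (((hu.pow m').mul (hv.pow n')).const_mul d)
  have h2 : fderiv ℝ (fun z => c * (uF a b z ^ m * vF a b z ^ n)
      + d * (uF a b z ^ m' * vF a b z ^ n')) z = _ := h.fderiv
  unfold YD
  rw [h2]
  simp [fderiv_uF, fderiv_vF]
  ring

/-- A field with `Xu = β v`, `Xv = γ u`, applied twice to a monomial. -/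
lemma YD_twice_off (X : ℂ × ℂ → ℂ × ℂ) (a b β γ : ℂ)
    (hu : ∀ z, uF a b (X z) = β * vF a b z) (hv : ∀ z, vF a b (X z) = γ * uF a b z)
    (m n : ℕ) (z : ℂ × ℂ) :
    YD X (YD X (fun z => uF a b z ^ m * vF a b z ^ n)) z =
      β ^ 2 * (m * ((m - 1 : ℕ) : ℂ) * uF a b z ^ (m - 2) * vF a b z ^ (n + 2))
      + β * γ * (2 * m * n + m + n) * (uF a b z ^ m * vF a b z ^ n)
      + γ ^ 2 * (n * ((n - 1 : ℕ) : ℂ) * uF a b z ^ (m + 2) * vF a b z ^ (n - 2)) := by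
  have h1 : YD X (fun z => uF a b z ^ m * vF a b z ^ n) =
      fun z => (m * β) * (uF a b z ^ (m - 1) * vF a b z ^ (n + 1))
        + (n * γ) * (uF a b z ^ (m + 1) * vF a b z ^ (n - 1)) := by
    funext z
    have := YD_mono_s6 X a b 1 0 m n 0 0 z
    simp only [one_mul, zero_mul, add_zero] at this
    rw [this, hu, hv]; ring
  rw [h1, YD_mono_s6, hu, hv]
  rcases m with _ | _ | m <;> rcases n with _ | _ | n <;> simp <;> ring

/-- A field with `Xu = α u`, `Xv = δ v`, applied twice to a monomial. -/
lemma YD_twice_diag (X : ℂ × ℂ → ℂ × ℂ) (a b α δ : ℂ)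
    (hu : ∀ z, uF a b (X z) = α * uF a b z) (hv : ∀ z, vF a b (X z) = δ * vF a b z)
    (m n : ℕ) (z : ℂ × ℂ) :
    YD X (YD X (fun z => uF a b z ^ m * vF a b z ^ n)) z =
      (m * α + n * δ) ^ 2 * (uF a b z ^ m * vF a b z ^ n) := by
  have h0 : ∀ c z, YD X (fun z => c * (uF a b z ^ m * vF a b z ^ n)) z =
      c * (m * α + n * δ) * (uF a b z ^ m * vF a b z ^ n) := by
    intro c z
    have := YD_mono_s6 X a b c 0 m n 0 0 z
    simp only [zero_mul, add_zero] at this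
    rw [this, hu, hv]
    rcases m with _ | m <;> rcases n with _ | n <;> simp <;> ring
  have h1 : YD X (fun z => uF a b z ^ m * vF a b z ^ n) =
      fun z => (m * α + n * δ) * (uF a b z ^ m * vF a b z ^ n) := by
    funext z
    have := h0 1 z
    simpa only [one_mul] using this
  rw [h1, h0]; ring

/-- `φ_p` is an eigenfunction of the Berger-sphere Laplacian
`Δ^{S³}_ε = -(ε⁻² Y₂² + Y₃² + Y₄²)` with eigenvalue `k(k+2) + (ε⁻² - 1)(2p - k)²`. -/
theorem berger_laplacian_phi (ε : ℝ) (hε : 0 < ε) (a b : ℂ) (hab : (a, b) ≠ (0, 0))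
    (k p : ℤ) (hk : 0 ≤ k) (hp0 : 0 ≤ p) (hpk : p ≤ k) (z : ℂ × ℂ) :
    -(((ε ^ 2)⁻¹ : ℝ) : ℂ) * YD Y2 (YD Y2 (phi a b k p)) z
      - YD Y3 (YD Y3 (phi a b k p)) z - YD Y4 (YD Y4 (phi a b k p)) z =
      (((k * (k + 2) : ℤ) : ℂ) + (((ε ^ 2)⁻¹ - 1 : ℝ) : ℂ) * ((2 * p - k : ℤ) : ℂ) ^ 2)
        * phi a b k p z := by
  obtain ⟨m, rfl⟩ := Int.eq_ofNat_of_zero_le hp0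
  obtain ⟨n, hn⟩ := Int.eq_ofNat_of_zero_le (sub_nonneg.2 hpk)
  obtain rfl : k = m + n := by omega
  have hphi : phi a b (m + n) m = fun z => uF a b z ^ m * vF a b z ^ n := by
    funext z
    simp [phi]
  rw [hphi,
    YD_twice_diag Y2 a b I (-I) (fun z => by simp [uF, Y2]; ring)
      (fun z => by simp [vF, Y2]; ring),
    YD_twice_off Y3 a b I I (fun z => by simp [uF, vF, Y3]; ring)
      (fun z => by simp [uF, vF, Y3]; ring),
    YD_twice_off Y4 a b (-1) 1 (fun z => by simp [uF, vF, Y4]; ring)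
      (fun z => by simp [uF, vF, Y4]; ring)]
  push_cast
  ring_nf
  simp only [I_sq]
  ring
end
end

section
/- Let ε > 0, t ∈ ℝ, and (a,b) ∈ ℂ² \ {(0,0)}. Writing Δ_ε^α f = −ε⁻²Y₂²f − Y₃²f − Y₄²f − 2it·Y₂f + ε²t²·f, the functions u and v satisfy, at every point of ℂ²: Δ_ε^α u = (2 + ε⁻² + 2t + ε²t²)·u and Δ_ε^α v = (2 + ε⁻² − 2t + ε²t²)·v. In particular u and v are eigenfunctions of the magnetic Laplacian on the Berger sphere (S³, g_ε) with potential α = εt·Y₂^ε, with the stated eigenvalues. -/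
open Complex

noncomputable section

/-- `u` as a continuous real-linear map. -/
def uL (a b : ℂ) : ℂ × ℂ →L[ℝ] ℂ :=
  a • ContinuousLinearMap.fst ℝ ℂ ℂ + b • ContinuousLinearMap.snd ℝ ℂ ℂ

/-- `v` as a continuous real-linear map. -/
def vL (a b : ℂ) : ℂ × ℂ →L[ℝ] ℂ :=
  b • ((conjCLE : ℂ →L[ℝ] ℂ).comp (ContinuousLinearMap.fst ℝ ℂ ℂ))
    - a • ((conjCLE : ℂ →L[ℝ] ℂ).comp (ContinuousLinearMap.snd ℝ ℂ ℂ))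

lemma hasFDerivAt_uF (a b : ℂ) (z : ℂ × ℂ) : HasFDerivAt (uF a b) (uL a b) z := by
  have h : uF a b = uL a b := by
    funext w
    simp [uF, uL]
  rw [h]
  exact (uL a b).hasFDerivAt

lemma hasFDerivAt_vF (a b : ℂ) (z : ℂ × ℂ) : HasFDerivAt (vF a b) (vL a b) z := by
  have h : vF a b = vL a b := by
    funext w
    simp [vF, vL]
  rw [h]
  exact (vL a b).hasFDerivAt

lemma YD_smul_uF (X : ℂ × ℂ → ℂ × ℂ) (c a b : ℂ) :
    YD X (fun z => c * uF a b z) = fun z => c * uF a b (X z) := by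
  funext z
  have h := ((hasFDerivAt_uF a b z).const_mul c).fderiv
  simp only [YD, h]
  simp [uF, uL, mul_add]

lemma YD_smul_vF (X : ℂ × ℂ → ℂ × ℂ) (c a b : ℂ) :
    YD X (fun z => c * vF a b z) = fun z => c * vF a b (X z) := by
  funext z
  have h := ((hasFDerivAt_vF a b z).const_mul c).fderiv
  simp only [YD, h]
  simp [vF, vL]

lemma YD_uF (X : ℂ × ℂ → ℂ × ℂ) (a b : ℂ) : YD X (uF a b) = fun z => uF a b (X z) := by
  simpa using YD_smul_uF X 1 a b

lemma YD_vF (X : ℂ × ℂ → ℂ × ℂ) (a b : ℂ) : YD X (vF a b) = fun z => vF a b (X z) := by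
  simpa using YD_smul_vF X 1 a b

lemma uF_Y2 (a b : ℂ) (z : ℂ × ℂ) : uF a b (Y2 z) = I * uF a b z := by
  simp only [uF, Y2]; ring

lemma uF_Y3 (a b : ℂ) (z : ℂ × ℂ) : uF a b (Y3 z) = I * vF a b z := by
  simp only [uF, vF, Y3]; ring

lemma uF_Y4 (a b : ℂ) (z : ℂ × ℂ) : uF a b (Y4 z) = (-1) * vF a b z := by
  simp only [uF, vF, Y4]; ring

lemma vF_Y2 (a b : ℂ) (z : ℂ × ℂ) : vF a b (Y2 z) = (-I) * vF a b z := by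
  simp only [vF, Y2, map_mul, conj_I]; ring

lemma vF_Y3 (a b : ℂ) (z : ℂ × ℂ) : vF a b (Y3 z) = I * uF a b z := by
  simp only [uF, vF, Y3, map_mul, map_neg, conj_I, conj_conj]; ring

lemma vF_Y4 (a b : ℂ) (z : ℂ × ℂ) : vF a b (Y4 z) = 1 * uF a b z := by
  simp only [uF, vF, Y4, map_neg, conj_conj]; ring

/-- `u` and `v` are eigenfunctions of the magnetic Laplacian
`Δ_ε^α f = -(ε⁻² Y₂² + Y₃² + Y₄²) f - 2it Y₂ f + ε²t² f` on the Berger sphere `(S³, g_ε)`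
with potential `α = εt Y₂^ε`, with eigenvalues `2 + ε⁻² + 2t + ε²t²` and
`2 + ε⁻² - 2t + ε²t²` respectively. -/
theorem magnetic_berger_u_v_eigenfunctions (ε t : ℝ) (hε : 0 < ε) (a b : ℂ)
    (hab : (a, b) ≠ (0, 0)) :
    (∀ z : ℂ × ℂ,
      -(((ε ^ 2)⁻¹ : ℝ) : ℂ) * YD Y2 (YD Y2 (uF a b)) z
        - YD Y3 (YD Y3 (uF a b)) z - YD Y4 (YD Y4 (uF a b)) z
        - 2 * I * (t : ℂ) * YD Y2 (uF a b) z + ((ε ^ 2 * t ^ 2 : ℝ) : ℂ) * uF a b z =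
        ((2 + (ε ^ 2)⁻¹ + 2 * t + ε ^ 2 * t ^ 2 : ℝ) : ℂ) * uF a b z) ∧
    (∀ z : ℂ × ℂ,
      -(((ε ^ 2)⁻¹ : ℝ) : ℂ) * YD Y2 (YD Y2 (vF a b)) z
        - YD Y3 (YD Y3 (vF a b)) z - YD Y4 (YD Y4 (vF a b)) z
        - 2 * I * (t : ℂ) * YD Y2 (vF a b) z + ((ε ^ 2 * t ^ 2 : ℝ) : ℂ) * vF a b z =
        ((2 + (ε ^ 2)⁻¹ - 2 * t + ε ^ 2 * t ^ 2 : ℝ) : ℂ) * vF a b z) := by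
  constructor
  · intro z
    simp only [YD_uF, uF_Y2, uF_Y3, uF_Y4, YD_smul_uF, YD_smul_vF, vF_Y3, vF_Y4]
    push_cast
    linear_combination (-((ε : ℂ) ^ 2)⁻¹ - 1 - 2 * t) * uF a b z * I_mul_I
  · intro z
    simp only [YD_vF, vF_Y2, vF_Y3, vF_Y4, YD_smul_uF, YD_smul_vF, uF_Y3, uF_Y4]
    push_cast
    linear_combination (-((ε : ℂ) ^ 2)⁻¹ - 1 + 2 * t) * vF a b z * I_mul_I
end
end
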